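/- Let G' = (V, E') be a finite directed acyclic graph with sources s_1,…,s_n (rates r_i > 0), sink t, capacities ν_e > 0, resetting arcs E* ⊆ E', such that every node is reachable from a source. Then there exists a thin flow with resetting on E*: a vector (x'_i) with x'_i ≥ 0 and Σ x'_i = 1, a static S⁺-t flow (x'_e) with source injections x'_i, and labels (ℓ'_v) satisfying ℓ'_{s_i} = x'_i/r_i for all i; ℓ'_{s_i} ≤ min_{e=(u,s_i)∈E'} ρ_e(ℓ'_u, x'_e) for all i; ℓ'_v = min_{e=(u,v)∈E'} ρ_e(ℓ'_u, x'_e) for all non-source v; and ℓ'_v = ρ_e(ℓ'_u, x'_e) for every arc e = (u,v) ∈ E' with x'_e > 0, where ρ_e(ℓ, x) = x/ν_e if e ∈ E* and max{ℓ, x/ν_e} otherwise. -/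

import Mathlib

/-- Net outflow of a static flow `x` at node `v` in the arc set `E'`. -/
def netOut {V : Type*} [DecidableEq V] (E' : Finset (V × V)) (x : V × V → ℝ) (v : V) : ℝ :=
  (∑ e ∈ E'.filter (fun e => e.1 = v), x e) - ∑ e ∈ E'.filter (fun e => e.2 = v), x e

/-- The arc set `E'` contains no directed cycle. -/
def NoCycle {V : Type*} (E' : Finset (V × V)) : Prop :=
  ∀ (k : ℕ) (w : Fin (k+1) → V), 0 < k →
    (∀ i : Fin k, (w i.castSucc, w i.succ) ∈ E') → w 0 ≠ w (Fin.last k)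

/-- Every node is reachable from the set `S` along arcs of `E'`. -/
def ReachesAll {V : Type*} (E' : Finset (V × V)) (S : Set V) : Prop :=
  ∀ v : V, ∃ (k : ℕ) (w : Fin (k+1) → V),
    w 0 ∈ S ∧ w (Fin.last k) = v ∧ ∀ i : Fin k, (w i.castSucc, w i.succ) ∈ E'

/-- The net outflow of a set of nodes is the flow on arcs with tail in the set minus the flow on
arcs with head in the set. -/
theorem sum_netOut {V : Type*} [DecidableEq V] (E' : Finset (V × V)) (x : V × V → ℝ)
    (D : Finset V) :
    ∑ v ∈ D, netOut E' x v =
      ∑ e ∈ E', ((if e.1 ∈ D then x e else 0) - (if e.2 ∈ D then x e else 0)) := by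
  simp only [netOut, Finset.sum_sub_distrib, Finset.sum_filter]
  congr 1 <;>
  · rw [Finset.sum_comm]
    simp

theorem NoCycle.not_transGen {V : Type*} [DecidableEq V] {E' : Finset (V × V)} (h : NoCycle E')
    (a : V) : ¬ Relation.TransGen (fun u v => (u, v) ∈ E') a a := by
  have key : ∀ a b, Relation.TransGen (fun u v => (u, v) ∈ E') a b →
      ∃ (k : ℕ) (w : ℕ → V), 0 < k ∧ w 0 = a ∧ w k = b ∧ ∀ i < k, (w i, w (i + 1)) ∈ E' := by
    intro a b hab
    induction hab using Relation.TransGen.head_induction_on with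
    | @single a hab => exact ⟨1, fun i => if i = 0 then a else b, by simp, by simp, by simp,
        fun i hi => by simpa [Nat.lt_one_iff.1 hi] using hab⟩
    | @head a c hac _ ih =>
      obtain ⟨k, w, hk, h0, hkb, hw⟩ := ih
      refine ⟨k + 1, fun i => Nat.casesOn i a w, by omega, rfl, hkb, ?_⟩
      rintro (_ | i) hi
      · simpa [h0] using hac
      · exact hw i (by omega)
  intro haa
  obtain ⟨k, w, hk, h0, hkb, hw⟩ := key a a haa
  exact h k (fun i => w i) hk (fun i => by simpa using hw i i.2) (by simp [h0, hkb])

theorem ReachesAll.induction {V : Type*} [DecidableEq V] {E' : Finset (V × V)} {S : Set V}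
    (h : ReachesAll E' S) {Q : V → Prop} (hS : ∀ v ∈ S, Q v)
    (hstep : ∀ e ∈ E', Q e.1 → Q e.2) (v : V) : Q v := by
  obtain ⟨k, w, h0, rfl, hw⟩ := h v
  have : ∀ i : Fin (k + 1), Q (w i) := fun i => by
    induction i using Fin.induction with
    | zero => exact hS _ h0
    | succ i ih => exact hstep _ (hw i) ih
  exact this _

section ArcFlow

variable {V : Type*} [DecidableEq V]

/-- A continuous regularization, of slope `k`, of the arc flow determined by node labels `ℓ`: a
resetting arc carries `ν e * ℓ e.2`; any other arc carries nothing when the label does not increase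
along it, and `ν e * ℓ e.2` when the label increases sufficiently. -/
noncomputable def arcFlow (E' Estar : Finset (V × V)) (ν : V × V → ℝ) (k : ℝ) (ℓ : V → ℝ)
    (e : V × V) : ℝ :=
  if e ∈ E' then
    (if e ∈ Estar then ν e * ℓ e.2 else ν e * min (ℓ e.2) (max 0 (k * (ℓ e.2 - ℓ e.1))))
  else 0

/-- The surplus at a node when it receives an external inflow `R v * ℓ v`. -/
noncomputable def excess (E' Estar : Finset (V × V)) (ν : V × V → ℝ) (R : V → ℝ) (k : ℝ)
    (ℓ : V → ℝ) (v : V) : ℝ :=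
  R v * ℓ v - netOut E' (arcFlow E' Estar ν k ℓ) v

variable {E' Estar : Finset (V × V)} {ν : V × V → ℝ} {R : V → ℝ} {k : ℝ} {ℓ ℓ' : V → ℝ}

theorem arcFlow_nonneg (hν : ∀ e ∈ E', 0 < ν e) (hℓ : ∀ v, 0 ≤ ℓ v) (e : V × V) :
    0 ≤ arcFlow E' Estar ν k ℓ e := by
  unfold arcFlow
  split_ifs with h1 h2
  · exact mul_nonneg (hν e h1).le (hℓ _)
  · exact mul_nonneg (hν e h1).le (le_min (hℓ _) (le_max_left _ _))
  · exact le_rfl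

theorem arcFlow_le (hν : ∀ e ∈ E', 0 < ν e) {e : V × V} (he : e ∈ E') :
    arcFlow E' Estar ν k ℓ e ≤ ν e * ℓ e.2 := by
  unfold arcFlow
  split_ifs with h2
  · exact le_rfl
  · exact mul_le_mul_of_nonneg_left (min_le_left _ _) (hν e he).le

theorem arcFlow_mono (hν : ∀ e ∈ E', 0 < ν e) (hk : 0 ≤ k) {e : V × V} (h1 : ℓ' e.1 ≤ ℓ e.1)
    (h2 : ℓ e.2 ≤ ℓ' e.2) : arcFlow E' Estar ν k ℓ e ≤ arcFlow E' Estar ν k ℓ' e := by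
  unfold arcFlow
  split_ifs with he
  · exact mul_le_mul_of_nonneg_left h2 (hν e he).le
  · have := (hν e he).le
    gcongr
  · exact le_rfl

theorem arcFlow_mul {c : ℝ} (hc : 0 ≤ c) (e : V × V) :
    arcFlow E' Estar ν k (fun v => c * ℓ v) e = c * arcFlow E' Estar ν k ℓ e := by
  unfold arcFlow
  split_ifs
  · ring
  · rw [show k * (c * ℓ e.2 - c * ℓ e.1) = c * (k * (ℓ e.2 - ℓ e.1)) by ring,
      show max 0 (c * (k * (ℓ e.2 - ℓ e.1))) = c * max 0 (k * (ℓ e.2 - ℓ e.1)) by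
        rw [mul_max_of_nonneg _ _ hc, mul_zero], ← mul_min_of_nonneg _ _ hc]
    ring
  · simp

theorem excess_mul {c : ℝ} (hc : 0 ≤ c) (v : V) :
    excess E' Estar ν R k (fun v => c * ℓ v) v = c * excess E' Estar ν R k ℓ v := by
  simp only [excess, netOut, arcFlow_mul hc, ← Finset.mul_sum]
  ring

theorem continuous_arcFlow (e : V × V) : Continuous fun ℓ : V → ℝ => arcFlow E' Estar ν k ℓ e := by
  unfold arcFlow
  split_ifs <;> fun_prop

theorem continuous_excess (v : V) : Continuous fun ℓ : V → ℝ => excess E' Estar ν R k ℓ v := by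
  have := fun e => continuous_arcFlow (E' := E') (Estar := Estar) (ν := ν) (k := k) e
  unfold excess netOut
  fun_prop

/-- The excess at a node does not increase when the labels of other nodes are raised. -/
theorem excess_le_of_le (hν : ∀ e ∈ E', 0 < ν e) (hk : 0 ≤ k) (hle : ∀ v, ℓ v ≤ ℓ' v) {v : V}
    (hv : ℓ' v = ℓ v) : excess E' Estar ν R k ℓ' v ≤ excess E' Estar ν R k ℓ v := by
  unfold excess netOut
  have h1 : ∑ e ∈ E'.filter (fun e => e.1 = v), arcFlow E' Estar ν k ℓ e ≤
      ∑ e ∈ E'.filter (fun e => e.1 = v), arcFlow E' Estar ν k ℓ' e := by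
    refine Finset.sum_le_sum fun e he => arcFlow_mono hν hk ?_ (hle _)
    rw [(Finset.mem_filter.1 he).2, hv]
  have h2 : ∑ e ∈ E'.filter (fun e => e.2 = v), arcFlow E' Estar ν k ℓ' e ≤
      ∑ e ∈ E'.filter (fun e => e.2 = v), arcFlow E' Estar ν k ℓ e := by
    refine Finset.sum_le_sum fun e he => arcFlow_mono hν hk (hle _) ?_
    rw [(Finset.mem_filter.1 he).2, hv]
  rw [hv]
  linarith

theorem excess_le_sum_in (hν : ∀ e ∈ E', 0 < ν e) (hℓ : ∀ v, 0 ≤ ℓ v) {v : V} (hv : R v = 0) :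
    excess E' Estar ν R k ℓ v ≤
      ∑ e ∈ E'.filter (fun e => e.2 = v), arcFlow E' Estar ν k ℓ e := by
  have : 0 ≤ ∑ e ∈ E'.filter (fun e => e.1 = v), arcFlow E' Estar ν k ℓ e :=
    Finset.sum_nonneg fun e _ => arcFlow_nonneg hν hℓ e
  unfold excess netOut
  rw [hv]
  linarith

/-- The label increase along an arc is bounded by its congestion. -/
theorem label_le_max_add (hν : ∀ e ∈ E', 0 < ν e) (hℓ : ∀ v, 0 ≤ ℓ v) (hk : 0 < k) {e : V × V}
    (he : e ∈ E') (hes : e ∉ Estar) :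
    ℓ e.2 ≤ max (ℓ e.1) (arcFlow E' Estar ν k ℓ e / ν e) +
      arcFlow E' Estar ν k ℓ e / ν e / k := by
  have hx := arcFlow_nonneg (Estar := Estar) (k := k) hν hℓ e
  have hdiv : arcFlow E' Estar ν k ℓ e / ν e =
      min (ℓ e.2) (max 0 (k * (ℓ e.2 - ℓ e.1))) := by
    rw [arcFlow, if_pos he, if_neg hes, mul_div_cancel_left₀ _ (hν e he).ne']
  have h0 : 0 ≤ arcFlow E' Estar ν k ℓ e / ν e / k := by
    have := hν e he
    positivity
  rcases le_total (ℓ e.2) (max 0 (k * (ℓ e.2 - ℓ e.1))) with h | h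
  · rw [min_eq_left h] at hdiv
    linarith [le_max_right (ℓ e.1) (arcFlow E' Estar ν k ℓ e / ν e)]
  · rw [min_eq_right h] at hdiv
    have h3 : ℓ e.2 - ℓ e.1 ≤ arcFlow E' Estar ν k ℓ e / ν e / k := by
      rw [hdiv, le_div_iff₀ hk, mul_comm]
      exact le_max_right _ _
    linarith [le_max_left (ℓ e.1) (arcFlow E' Estar ν k ℓ e / ν e)]

theorem label_le_add (hν : ∀ e ∈ E', 0 < ν e) (hℓ : ∀ v, 0 ≤ ℓ v) (hk : 1 ≤ k) {e : V × V}
    (he : e ∈ E') : ℓ e.2 ≤ ℓ e.1 + 2 * (arcFlow E' Estar ν k ℓ e / ν e) := by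
  have hx : 0 ≤ arcFlow E' Estar ν k ℓ e / ν e :=
    div_nonneg (arcFlow_nonneg hν hℓ e) (hν e he).le
  by_cases hes : e ∈ Estar
  · have hdiv : arcFlow E' Estar ν k ℓ e / ν e = ℓ e.2 := by
      rw [arcFlow, if_pos he, if_pos hes, mul_div_cancel_left₀ _ (hν e he).ne']
    linarith [hℓ e.1, hℓ e.2]
  · have h1 := label_le_max_add hν hℓ (zero_lt_one.trans_le hk) he hes
    have h2 : max (ℓ e.1) (arcFlow E' Estar ν k ℓ e / ν e) ≤
        ℓ e.1 + arcFlow E' Estar ν k ℓ e / ν e := max_le (by linarith) (by linarith [hℓ e.1])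
    have h3 := div_le_self hx hk
    linarith

/-- The labels at which every node but `t` has nonpositive excess. -/
def IsSubsolution (E' Estar : Finset (V × V)) (ν : V × V → ℝ) (R : V → ℝ) (t : V) (k : ℝ)
    (ℓ : V → ℝ) : Prop :=
  (∀ v, 0 ≤ ℓ v) ∧ ∀ v, v ≠ t → excess E' Estar ν R k ℓ v ≤ 0

variable {t : V}

theorem IsSubsolution.sum_le (h : IsSubsolution E' Estar ν R t k ℓ) (D : Finset V)
    (hD : t ∈ D) : ∑ v ∈ D, excess E' Estar ν R k ℓ v ≤ excess E' Estar ν R k ℓ t := by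
  rw [← Finset.add_sum_erase _ _ hD]
  have := Finset.sum_nonpos (s := D.erase t) fun v hv => h.2 v (Finset.ne_of_mem_erase hv)
  linarith

variable [Fintype V]

theorem IsSubsolution.rate_mul_le (h : IsSubsolution E' Estar ν R t k ℓ) (hR : ∀ v, 0 ≤ R v)
    (v : V) : R v * ℓ v ≤ excess E' Estar ν R k ℓ t := by
  refine le_trans ?_ (h.sum_le Finset.univ (Finset.mem_univ _))
  have h0 : ∑ v, netOut E' (arcFlow E' Estar ν k ℓ) v = 0 := by
    rw [sum_netOut]
    simp
  simp only [excess, Finset.sum_sub_distrib, h0, sub_zero]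
  exact Finset.single_le_sum (f := fun v => R v * ℓ v)
    (fun v _ => mul_nonneg (hR v) (h.1 v)) (Finset.mem_univ v)

/-- In a subsolution on an acyclic graph, no arc carries more than the excess of the sink. -/
theorem IsSubsolution.arcFlow_le_excess (h : IsSubsolution E' Estar ν R t k ℓ)
    (hR : ∀ v, 0 ≤ R v) (hν : ∀ e ∈ E', 0 < ν e) (hacyc : NoCycle E') {e : V × V}
    (he : e ∈ E') : arcFlow E' Estar ν k ℓ e ≤ excess E' Estar ν R k ℓ t := by
  classical
  set D : Finset V :=
    Finset.univ.filter (fun w => Relation.ReflTransGen (fun u v => (u, v) ∈ E') e.2 w) with hDdef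
  have hx := arcFlow_nonneg (Estar := Estar) (k := k) hν h.1
  have he1 : e.1 ∉ D := fun hmem =>
    hacyc.not_transGen e.1 (Relation.TransGen.head' he (Finset.mem_filter.1 hmem).2)
  have he2 : e.2 ∈ D := by simp [hDdef, Relation.ReflTransGen.refl]
  have hclosed : ∀ a ∈ E', a.1 ∈ D → a.2 ∈ D := fun a ha hmem => by
    simp only [hDdef, Finset.mem_filter, Finset.mem_univ, true_and] at hmem ⊢
    exact hmem.tail ha
  have hterm : ∀ a ∈ E', 0 ≤ (if a.2 ∈ D then arcFlow E' Estar ν k ℓ a else 0) -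
      (if a.1 ∈ D then arcFlow E' Estar ν k ℓ a else 0) := fun a ha => by
    have := hclosed a ha
    have := hx a
    split_ifs <;> simp_all
  have hle : arcFlow E' Estar ν k ℓ e ≤ ∑ v ∈ D, excess E' Estar ν R k ℓ v := by
    have h1 := Finset.single_le_sum hterm he
    rw [if_pos he2, if_neg he1, sub_zero] at h1
    have h2 : 0 ≤ ∑ v ∈ D, R v * ℓ v := Finset.sum_nonneg fun v _ => mul_nonneg (hR v) (h.1 v)
    simp only [excess, Finset.sum_sub_distrib, sum_netOut] at h1 ⊢
    linarith
  by_cases ht : t ∈ D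
  · exact hle.trans (h.sum_le D ht)
  · have h1 : ∑ v ∈ D, excess E' Estar ν R k ℓ v ≤ 0 :=
      Finset.sum_nonpos fun v hv => h.2 v (fun hvt => ht (hvt ▸ hv))
    have h2 := (mul_nonneg (hR t) (h.1 t)).trans (h.rate_mul_le hR t)
    linarith

theorem exists_label_bound (hR : ∀ v, 0 ≤ R v) (hν : ∀ e ∈ E', 0 < ν e) (hacyc : NoCycle E')
    (hreach : ReachesAll E' {v | 0 < R v}) (Estar : Finset (V × V)) (t : V) (v : V) :
    ∃ M : ℝ, ∀ k, 1 ≤ k → ∀ ℓ, IsSubsolution E' Estar ν R t k ℓ →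
      ℓ v ≤ M * excess E' Estar ν R k ℓ t := by
  induction v using hreach.induction with
  | hS v hv =>
    refine ⟨1 / R v, fun k _ ℓ h => ?_⟩
    have := h.rate_mul_le hR v
    rw [one_div_mul_eq_div, le_div_iff₀ hv]
    linarith
  | hstep e he ih =>
    obtain ⟨M, hM⟩ := ih
    refine ⟨M + 2 / ν e, fun k hk ℓ h => ?_⟩
    have h1 := hM k hk ℓ h
    have h2 := label_le_add (Estar := Estar) hν h.1 hk he
    have h3 := div_le_div_of_nonneg_right (h.arcFlow_le_excess hR hν hacyc he) (hν e he).le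
    have h4 : (M + 2 / ν e) * excess E' Estar ν R k ℓ t =
        M * excess E' Estar ν R k ℓ t + 2 * (excess E' Estar ν R k ℓ t / ν e) := by ring
    linarith

/-- For every slope there are labels balancing all nodes but the sink, such that every node
without external inflow has an incoming arc which is resetting or along which the label does not
decrease. -/
theorem exists_balanced_labels (hR : ∀ v, 0 ≤ R v) (hν : ∀ e ∈ E', 0 < ν e)
    (hacyc : NoCycle E') (hreach : ReachesAll E' {v | 0 < R v}) (ht : R t = 0) (hk : 1 ≤ k) :
    ∃ ℓ : V → ℝ, (∀ v, 0 ≤ ℓ v) ∧ (∀ v, v ≠ t → excess E' Estar ν R k ℓ v = 0) ∧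
      excess E' Estar ν R k ℓ t = 1 ∧
      ∀ v, R v = 0 → ∃ e ∈ E', e.2 = v ∧ (e ∈ Estar ∨ ℓ e.1 ≤ ℓ v) := by
  have hk0 : 0 ≤ k := zero_le_one.trans hk
  choose M hM using exists_label_bound hR hν hacyc hreach Estar t
  set S : Set (V → ℝ) := {ℓ | IsSubsolution E' Estar ν R t k ℓ ∧ ℓ t = 1} with hS
  have hin : ∀ v, R v = 0 → ∃ e ∈ E', e.2 = v := by
    intro v hv
    have : 0 < R v ∨ ∃ e ∈ E', e.2 = v :=
      hreach.induction (Q := fun v => 0 < R v ∨ ∃ e ∈ E', e.2 = v) (fun v hv => Or.inl hv)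
        (fun e he _ => Or.inr ⟨e, he, rfl⟩) v
    exact this.resolve_left (by simp [hv])
  have hFpos : ∀ ℓ ∈ S, 0 < excess E' Estar ν R k ℓ t := by
    rintro ℓ ⟨h, h1⟩
    have h2 := (mul_nonneg (hR t) (h.1 t)).trans (h.rate_mul_le hR t)
    refine lt_of_le_of_ne h2 fun h0 => ?_
    have := hM t k hk ℓ h
    rw [← h0, h1] at this
    linarith
  have hFle : ∀ ℓ ∈ S, excess E' Estar ν R k ℓ t ≤ ∑ e ∈ E'.filter (fun e => e.2 = t), ν e := by
    rintro ℓ ⟨h, h1⟩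
    refine (excess_le_sum_in hν h.1 ht).trans (Finset.sum_le_sum fun e he => ?_)
    obtain ⟨he, het⟩ := Finset.mem_filter.1 he
    simpa [het, h1] using arcFlow_le (Estar := Estar) (k := k) (ℓ := ℓ) hν he
  have hcompact : IsCompact S := by
    set F := ∑ e ∈ E'.filter (fun e => e.2 = t), ν e
    refine (isCompact_univ_pi fun v =>
      isCompact_Icc (a := (0 : ℝ)) (b := |M v| * F)).of_isClosed_subset ?_ ?_
    · have := fun v => continuous_excess (E' := E') (Estar := Estar) (ν := ν) (R := R) (k := k) v
      simp only [hS, IsSubsolution, Set.ofPred_and, Set.ofPred_forall]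
      refine IsClosed.inter (IsClosed.inter ?_ ?_) (isClosed_eq (continuous_apply t) continuous_const)
      · exact isClosed_iInter fun v => isClosed_le continuous_const (continuous_apply v)
      · exact isClosed_iInter fun v => isClosed_iInter fun _ => isClosed_le (this v) continuous_const
    · intro ℓ hℓ v _
      refine ⟨hℓ.1.1 v, (hM v k hk ℓ hℓ.1).trans ?_⟩
      exact mul_le_mul (le_abs_self _) (hFle ℓ hℓ) (hFpos ℓ hℓ).le (abs_nonneg _)
  have hne : S.Nonempty := by
    have h0 : ∀ v, 0 ≤ (Pi.single t 1 : V → ℝ) v := fun v => by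
      by_cases h : v = t <;> simp [h]
    refine ⟨Pi.single t 1, ⟨h0, fun v hv => ?_⟩, by simp⟩
    have h1 : ∑ e ∈ E'.filter (fun e => e.2 = v),
        arcFlow E' Estar ν k (Pi.single t 1 : V → ℝ) e ≤ 0 := by
      refine Finset.sum_nonpos fun e he => ?_
      obtain ⟨he, hev⟩ := Finset.mem_filter.1 he
      refine (arcFlow_le hν he).trans ?_
      simp [hev, Pi.single_eq_of_ne hv]
    have h2 : 0 ≤ ∑ e ∈ E'.filter (fun e => e.1 = v),
        arcFlow E' Estar ν k (Pi.single t 1 : V → ℝ) e :=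
      Finset.sum_nonneg fun e _ => arcFlow_nonneg hν h0 e
    simp only [excess, netOut, Pi.single_eq_of_ne hv]
    linarith
  obtain ⟨ℓ, hℓS, hmax⟩ := hcompact.exists_isMaxOn hne
    (f := fun ℓ : V → ℝ => ∑ v, ℓ v) (by fun_prop)
  have hraise : ∀ v, v ≠ t → ∀ y, ℓ v < y →
      0 < excess E' Estar ν R k (Function.update ℓ v y) v := by
    intro v hv y hy
    by_contra! hcon
    have hle : ∀ w, ℓ w ≤ Function.update ℓ v y w := fun w => by
      by_cases h : w = v
      · subst h; simpa using hy.le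
      · simp [h]
    have hmem : Function.update ℓ v y ∈ S := by
      refine ⟨⟨fun w => (hℓS.1.1 w).trans (hle w), fun w hw => ?_⟩, ?_⟩
      · by_cases h : w = v
        · rwa [h]
        · exact (excess_le_of_le hν hk0 hle (by simp [h])).trans (hℓS.1.2 w hw)
      · simpa [hv.symm] using hℓS.2
    have h1 : ∑ w, Function.update ℓ v y w ≤ ∑ w, ℓ w := hmax hmem
    have h2 : ∑ w, ℓ w < ∑ w, Function.update ℓ v y w :=
      Finset.sum_lt_sum (fun w _ => hle w) ⟨v, Finset.mem_univ v, by simpa using hy⟩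
    linarith
  have hbal : ∀ v, v ≠ t → excess E' Estar ν R k ℓ v = 0 := by
    intro v hv
    refine le_antisymm (hℓS.1.2 v hv) ?_
    have hc : Continuous fun y => excess E' Estar ν R k (Function.update ℓ v y) v :=
      (continuous_excess v).comp (continuous_const.update v continuous_id)
    have htend := (hc.tendsto (ℓ v)).mono_left (nhdsWithin_le_nhds (s := Set.Ioi (ℓ v)))
    rw [Function.update_eq_self] at htend
    refine ge_of_tendsto htend ?_
    filter_upwards [self_mem_nhdsWithin] with y hy using (hraise v hv y hy).le
  have hzero : ∀ ℓ' : V → ℝ, (∀ v, 0 ≤ ℓ' v) → ∀ v, R v = 0 →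
      (∀ e ∈ E', e.2 = v → e ∉ Estar ∧ ℓ' v ≤ ℓ' e.1) → excess E' Estar ν R k ℓ' v ≤ 0 := by
    intro ℓ' hℓ' v hv hall
    refine (excess_le_sum_in hν hℓ' hv).trans (Finset.sum_nonpos fun e he => ?_)
    obtain ⟨he, hev⟩ := Finset.mem_filter.1 he
    obtain ⟨h1, h2⟩ := hall e he hev
    have h3 : max 0 (k * (ℓ' e.2 - ℓ' e.1)) = 0 :=
      max_eq_left (mul_nonpos_of_nonneg_of_nonpos hk0 (by rw [hev]; linarith))
    rw [arcFlow, if_pos he, if_neg h1, h3, min_eq_right (hℓ' _), mul_zero]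
  have htight : ∀ v, R v = 0 → ∃ e ∈ E', e.2 = v ∧ (e ∈ Estar ∨ ℓ e.1 ≤ ℓ v) := by
    intro v hv
    by_contra! hcon
    by_cases hvt : v = t
    · subst hvt
      have := hzero ℓ hℓS.1.1 v hv fun e he hev => ⟨(hcon e he hev).1, (hcon e he hev).2.le⟩
      linarith [hFpos ℓ hℓS]
    · obtain ⟨e₀, he₀, hev₀⟩ := hin v hv
      obtain ⟨a, ha, hmin⟩ := (E'.filter (fun e => e.2 = v)).exists_min_image
        (fun e => ℓ e.1) ⟨e₀, Finset.mem_filter.2 ⟨he₀, hev₀⟩⟩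
      obtain ⟨ha, hav⟩ := Finset.mem_filter.1 ha
      have hlt := (hcon a ha hav).2
      refine (hraise v hvt _ hlt).not_ge (hzero _ (fun w => ?_) v hv fun e he hev => ?_)
      · by_cases h : w = v
        · subst h; simpa using hℓS.1.1 _
        · simpa [h] using hℓS.1.1 w
      · refine ⟨(hcon e he hev).1, ?_⟩
        have hne : e.1 ≠ v := fun h => by
          have := (hcon e he hev).2
          rw [h] at this
          exact this.false
        simpa [hne] using hmin e (Finset.mem_filter.2 ⟨he, hev⟩)
  have hF := hFpos ℓ hℓS
  have hc : 0 ≤ (excess E' Estar ν R k ℓ t)⁻¹ := (inv_pos.2 hF).le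
  refine ⟨fun v => (excess E' Estar ν R k ℓ t)⁻¹ * ℓ v, fun v => mul_nonneg hc (hℓS.1.1 v),
    fun v hv => by rw [excess_mul hc, hbal v hv, mul_zero],
    by rw [excess_mul hc, inv_mul_cancel₀ hF.ne'], fun v hv => ?_⟩
  obtain ⟨e, he, hev, h⟩ := htight v hv
  exact ⟨e, he, hev, h.imp_right fun h => mul_le_mul_of_nonneg_left h hc⟩

/-- Labels `p.1` and flows `p.2` satisfying all thin flow conditions, except that the upper bound
on the label at the head of a non-resetting arc may be violated by `δ / ν e`. -/
def approxThinFlows (E' Estar : Finset (V × V)) (ν : V × V → ℝ) (R : V → ℝ) (t : V) (M : V → ℝ)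
    (δ : ℝ) : Set ((V → ℝ) × (V × V → ℝ)) :=
  {p | (∀ v, p.1 v ∈ Set.Icc 0 (M v)) ∧ (∀ e, p.2 e ∈ Set.Icc 0 1) ∧ (∀ e ∉ E', p.2 e = 0) ∧
    (∀ v, v ≠ t → netOut E' p.2 v = R v * p.1 v) ∧ ∑ v, R v * p.1 v = 1 ∧
    (∀ e ∈ Estar, e ∈ E' → p.2 e = ν e * p.1 e.2) ∧
    (∀ e ∈ E', p.2 e ≤ ν e * p.1 e.2) ∧
    (∀ e ∈ E', e ∉ Estar → p.2 e * max 0 (p.1 e.1 - p.1 e.2) = 0) ∧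
    (∀ e ∈ E', e ∉ Estar → p.1 e.2 ≤ max (p.1 e.1) (p.2 e / ν e) + δ / ν e) ∧
    (∀ v, R v = 0 → ∃ e ∈ E', e.2 = v ∧ (e ∈ Estar ∨ p.1 e.1 ≤ p.1 v))}

theorem isClosed_approxThinFlows (M : V → ℝ) (δ : ℝ) :
    IsClosed (approxThinFlows E' Estar ν R t M δ) := by
  have hnet : ∀ v, Continuous fun p : (V → ℝ) × (V × V → ℝ) => netOut E' p.2 v := fun v => by
    unfold netOut
    fun_prop
  have hex : ∀ v, IsClosed {p : (V → ℝ) × (V × V → ℝ) |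
      ∃ e ∈ E', e.2 = v ∧ (e ∈ Estar ∨ p.1 e.1 ≤ p.1 v)} := fun v => by
    have : {p : (V → ℝ) × (V × V → ℝ) | ∃ e ∈ E', e.2 = v ∧ (e ∈ Estar ∨ p.1 e.1 ≤ p.1 v)} =
        ⋃ e ∈ E', {p | e.2 = v ∧ (e ∈ Estar ∨ p.1 e.1 ≤ p.1 v)} := by
      ext p
      simp
    rw [this]
    refine isClosed_biUnion_finset fun e _ => ?_
    simp only [Set.ofPred_and, Set.ofPred_or]
    exact isClosed_const.inter (isClosed_const.union (isClosed_le (by fun_prop) (by fun_prop)))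
  simp only [approxThinFlows, Set.ofPred_and, Set.ofPred_forall, Set.mem_Icc]
  repeat' first | apply IsClosed.inter | refine isClosed_iInter fun _ => ?_
  all_goals first
    | exact hex _
    | exact isClosed_eq (hnet _) (by fun_prop)
    | exact isClosed_le (by fun_prop) (by fun_prop)
    | exact isClosed_eq (by fun_prop) (by fun_prop)

theorem isCompact_approxThinFlows (M : V → ℝ) (δ : ℝ) :
    IsCompact (approxThinFlows E' Estar ν R t M δ) :=
  ((isCompact_univ_pi fun v => isCompact_Icc (a := (0 : ℝ)) (b := M v)).prod
    (isCompact_univ_pi fun _ => isCompact_Icc (a := (0 : ℝ)) (b := 1))).of_isClosed_subset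
    (isClosed_approxThinFlows M δ) fun _ hp => ⟨fun v _ => hp.1 v, fun e _ => hp.2.1 e⟩

theorem exists_approxThinFlows_nonempty (hR : ∀ v, 0 ≤ R v) (hν : ∀ e ∈ E', 0 < ν e)
    (hacyc : NoCycle E') (hreach : ReachesAll E' {v | 0 < R v}) (ht : R t = 0) :
    ∃ M : V → ℝ, ∀ k : ℝ, 1 ≤ k → (approxThinFlows E' Estar ν R t M (1 / k)).Nonempty := by
  choose M hM using exists_label_bound hR hν hacyc hreach Estar t
  refine ⟨M, fun k hk => ?_⟩
  have hk0 : 0 < k := zero_lt_one.trans_le hk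
  obtain ⟨ℓ, hℓ, hbal, hone, htight⟩ :=
    exists_balanced_labels (Estar := Estar) hR hν hacyc hreach ht hk
  have hsub : IsSubsolution E' Estar ν R t k ℓ := ⟨hℓ, fun v hv => (hbal v hv).le⟩
  have hx1 : ∀ e ∈ E', arcFlow E' Estar ν k ℓ e ≤ 1 := fun e he =>
    hone ▸ hsub.arcFlow_le_excess hR hν hacyc he
  refine ⟨(ℓ, arcFlow E' Estar ν k ℓ), fun v => ⟨hℓ v, ?_⟩, fun e => ⟨arcFlow_nonneg hν hℓ e, ?_⟩,
    fun e he => if_neg he, fun v hv => ?_, ?_, fun e hes he => ?_, fun e he => arcFlow_le hν he,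
    fun e he hes => ?_, fun e he hes => ?_, htight⟩
  · simpa [hone] using hM v k hk ℓ hsub
  · by_cases he : e ∈ E'
    · exact hx1 e he
    · simp [arcFlow, he]
  · have := hbal v hv
    unfold excess at this
    linarith
  · have h0 : ∑ v, netOut E' (arcFlow E' Estar ν k ℓ) v = 0 := by
      rw [sum_netOut]
      simp
    have h1 : ∑ v, excess E' Estar ν R k ℓ v = 1 := by
      rw [← hone]
      exact Finset.sum_eq_single t (fun v _ hv => hbal v hv) (by simp)
    simpa [excess, Finset.sum_sub_distrib, h0] using h1
  · simp [arcFlow, he, hes]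
  · rcases le_total (ℓ e.1) (ℓ e.2) with h | h
    · simp [h]
    · have h3 : max 0 (k * (ℓ e.2 - ℓ e.1)) = 0 :=
        max_eq_left (mul_nonpos_of_nonneg_of_nonpos hk0.le (by linarith))
      simp [arcFlow, he, hes, h3, hℓ e.2]
  · refine (label_le_max_add hν hℓ hk0 he hes).trans ?_
    have h1 : arcFlow E' Estar ν k ℓ e / ν e / k ≤ 1 / k / ν e := by
      rw [div_right_comm]
      exact div_le_div_of_nonneg_right (div_le_div_of_nonneg_right (hx1 e he) hk0.le) (hν e he).le
    simpa using h1

theorem approxThinFlows_zero_nonempty (hR : ∀ v, 0 ≤ R v) (hν : ∀ e ∈ E', 0 < ν e)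
    (hacyc : NoCycle E') (hreach : ReachesAll E' {v | 0 < R v}) (ht : R t = 0) :
    ∃ M : V → ℝ, (approxThinFlows E' Estar ν R t M 0).Nonempty := by
  obtain ⟨M, hM⟩ := exists_approxThinFlows_nonempty (Estar := Estar) hR hν hacyc hreach ht
  refine ⟨M, ?_⟩
  have hanti : ∀ j : ℕ, approxThinFlows E' Estar ν R t M (1 / (((j + 1 : ℕ) : ℝ) + 1)) ⊆
      approxThinFlows E' Estar ν R t M (1 / ((j : ℝ) + 1)) := by
    rintro j p ⟨h1, h2, h3, h4, h5, h6, h7, h8, h9, h10⟩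
    refine ⟨h1, h2, h3, h4, h5, h6, h7, h8, fun e he hes => (h9 e he hes).trans ?_, h10⟩
    have := (hν e he).le
    push_cast
    gcongr
    simp
  obtain ⟨p, hp⟩ := IsCompact.nonempty_iInter_of_sequence_nonempty_isCompact_isClosed
    (fun j : ℕ => approxThinFlows E' Estar ν R t M (1 / ((j : ℝ) + 1))) hanti
    (fun j => hM _ (by simp)) (isCompact_approxThinFlows M _)
    (fun j => isClosed_approxThinFlows M _)
  rw [Set.mem_iInter] at hp
  obtain ⟨h1, h2, h3, h4, h5, h6, h7, h8, -, h10⟩ := hp 0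
  refine ⟨p, h1, h2, h3, h4, h5, h6, h7, h8, fun e he hes => ?_, h10⟩
  have htend := ((tendsto_one_div_add_atTop_nhds_zero_nat (𝕜 := ℝ)).div_const (ν e)).const_add
    (max (p.1 e.1) (p.2 e / ν e))
  exact ge_of_tendsto' htend fun j => (hp j).2.2.2.2.2.2.2.2.1 e he hes

end ArcFlow

/-- Existence of a thin flow with resetting on any acyclic graph with
multiple sources and a single sink. -/
theorem stmt_10 {V : Type*} [Fintype V] [DecidableEq V]
    (E' Estar : Finset (V × V)) (hEsub : Estar ⊆ E')
    (hacyc : NoCycle E')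
    (n : ℕ) (hn : 0 < n) (s : Fin n → V) (hs : Function.Injective s)
    (t : V) (hst : ∀ i, s i ≠ t)
    (hreach : ReachesAll E' (Set.range s))
    (r : Fin n → ℝ) (hr : ∀ i, 0 < r i)
    (ν : V × V → ℝ) (hν : ∀ e ∈ E', 0 < ν e) :
    ∃ (xi : Fin n → ℝ) (x : V × V → ℝ) (ℓ : V → ℝ),
      (∀ i, 0 ≤ xi i) ∧ (∑ i, xi i = 1) ∧
      (∀ e, 0 ≤ x e) ∧ (∀ e ∉ E', x e = 0) ∧
      (∀ v, (∀ i, v ≠ s i) → v ≠ t → netOut E' x v = 0) ∧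
      (∀ i, netOut E' x (s i) = xi i) ∧
      (∀ i, ℓ (s i) = xi i / r i) ∧
      (∀ i, ∀ e ∈ E', e.2 = s i →
        ℓ (s i) ≤ (if e ∈ Estar then x e / ν e else max (ℓ e.1) (x e / ν e))) ∧
      (∀ v, (∀ i, v ≠ s i) →
        (∀ e ∈ E', e.2 = v →
          ℓ v ≤ (if e ∈ Estar then x e / ν e else max (ℓ e.1) (x e / ν e))) ∧
        (∃ e ∈ E', e.2 = v ∧
          ℓ v = (if e ∈ Estar then x e / ν e else max (ℓ e.1) (x e / ν e)))) ∧
      (∀ e ∈ E', 0 < x e →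
        ℓ e.2 = (if e ∈ Estar then x e / ν e else max (ℓ e.1) (x e / ν e))) := by
  classical
  set R : V → ℝ := fun v => ∑ i, if s i = v then r i else 0 with hRdef
  have hRs : ∀ i, R (s i) = r i := fun i => by simp [hRdef, hs.eq_iff]
  have hR0 : ∀ v, (∀ i, v ≠ s i) → R v = 0 := fun v hv =>
    Finset.sum_eq_zero fun i _ => if_neg (hv i).symm
  have hR : ∀ v, 0 ≤ R v := fun v =>
    Finset.sum_nonneg fun i _ => by split_ifs <;> simp [(hr i).le]
  have hreach' : ReachesAll E' {v | 0 < R v} := fun v => by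
    obtain ⟨k, w, ⟨i, hi⟩, h⟩ := hreach v
    exact ⟨k, w, by simp [← hi, hRs, hr i], h⟩
  have ht : R t = 0 := hR0 t fun i => (hst i).symm
  obtain ⟨M, ⟨ℓ, x⟩, hℓ, hx, hxE, hbal, hsum, hreset, hle, hsupp, hup, htight⟩ :=
    approxThinFlows_zero_nonempty (Estar := Estar) hR hν hacyc hreach' ht
  simp only [zero_div, add_zero] at hℓ hx hxE hbal hsum hreset hle hsupp hup htight
  have hupper : ∀ e ∈ E', ℓ e.2 ≤
      (if e ∈ Estar then x e / ν e else max (ℓ e.1) (x e / ν e)) := fun e he => by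
    split_ifs with hes
    · rw [hreset e hes he, mul_div_cancel_left₀ _ (hν e he).ne']
    · exact hup e he hes
  have hlower : ∀ e ∈ E', (e ∈ Estar ∨ ℓ e.1 ≤ ℓ e.2) →
      ℓ e.2 = (if e ∈ Estar then x e / ν e else max (ℓ e.1) (x e / ν e)) := fun e he h => by
    refine le_antisymm (hupper e he) ?_
    have h1 : x e / ν e ≤ ℓ e.2 := by
      rw [div_le_iff₀ (hν e he), mul_comm]
      exact hle e he
    split_ifs with hes
    · exact h1
    · exact max_le (h.resolve_left hes) h1
  refine ⟨fun i => r i * ℓ (s i), x, ℓ, fun i => mul_nonneg (hr i).le (hℓ _).1, ?_,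
    fun e => (hx e).1, hxE, fun v hv hvt => ?_, fun i => ?_, fun i => ?_, fun i e he hei => ?_,
    fun v hv => ⟨fun e he hev => hev ▸ hupper e he, ?_⟩, fun e he hpos => hlower e he ?_⟩
  · rw [← hsum]
    simp only [hRdef, Finset.sum_mul, ite_mul, zero_mul]
    rw [Finset.sum_comm]
    simp
  · rw [hbal v hvt, hR0 v hv, zero_mul]
  · rw [hbal _ (hst i), hRs]
  · rw [mul_div_cancel_left₀ _ (hr i).ne']
  · exact hei ▸ hupper e he
  · obtain ⟨e, he, rfl, h⟩ := htight v (hR0 v hv)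
    exact ⟨e, he, rfl, hlower e he h⟩
  · by_cases hes : e ∈ Estar
    · exact Or.inl hes
    · have h := (mul_eq_zero.1 (hsupp e he hes)).resolve_left hpos.ne'
      exact Or.inr (by linarith [le_max_right 0 (ℓ e.1 - ℓ e.2)])
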